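/- arXiv:2312.08794 — 4 statements merged into one kernel-verified Lean document; each statement's English description precedes it below -/
import Mathlib

section
/- Let R be a field and c ∈ M_n(R). Then the centralizer algebra S_n(c,R) is anti-isomorphic to itself, i.e., S_n(c,R) ≅ S_n(c,R)^op as R-algebras. -/
open Polynomial

theorem Polynomial.exists_functional_ker_dvd {K : Type*} [Field K] {q : K[X]} (hq : q ≠ 0) :
    ∃ l : K[X] →ₗ[K] K, (∀ g, q ∣ g → l g = 0) ∧ ∀ g, (∀ h, l (g * h) = 0) → q ∣ g := by
  have hm : (q * C q.leadingCoeff⁻¹).Monic := monic_mul_leadingCoeff_inv hq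
  have hdvd : ∀ g, q * C q.leadingCoeff⁻¹ ∣ g ↔ q ∣ g := fun g =>
    (associated_mul_unit_left q _ (isUnit_C.2 (by simpa using hq))).dvd_iff_dvd_left
  set m := q * C q.leadingCoeff⁻¹
  refine ⟨lcoeff K (m.natDegree - 1) ∘ₗ modByMonicHom m, fun g hg => ?_, fun g hg => ?_⟩
  · simp [(modByMonic_eq_zero_iff_dvd hm).2 ((hdvd g).2 hg)]
  · by_contra hng
    rw [← hdvd, ← modByMonic_eq_zero_iff_dvd hm] at hng
    have hlt : (g %ₘ m).natDegree < m.natDegree :=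
      natDegree_lt_natDegree hng (degree_modByMonic_lt g hm)
    specialize hg (X ^ (m.natDegree - 1 - (g %ₘ m).natDegree))
    have hmod : (g * X ^ (m.natDegree - 1 - (g %ₘ m).natDegree)) %ₘ m =
        (g %ₘ m) * X ^ (m.natDegree - 1 - (g %ₘ m).natDegree) := by
      refine Eq.trans ?_ ((modByMonic_eq_self_iff hm).2 ?_)
      · refine modByMonic_eq_of_dvd_sub hm ?_
        rw [← sub_mul]
        refine Dvd.dvd.mul_right ?_ _
        exact ⟨g /ₘ m, by rw [sub_eq_iff_eq_add', modByMonic_add_div g m]⟩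
      · rw [degree_eq_natDegree (mul_ne_zero hng (pow_ne_zero _ X_ne_zero)),
          degree_eq_natDegree hm.ne_zero, Nat.cast_lt, natDegree_mul_X_pow _ hng]
        lia
    rw [LinearMap.comp_apply, modByMonicHom_apply, hmod, lcoeff_apply,
      coeff_mul_X_pow', if_pos (by lia),
      show m.natDegree - 1 - (m.natDegree - 1 - (g %ₘ m).natDegree) = (g %ₘ m).natDegree by lia,
      coeff_natDegree, leadingCoeff_eq_zero] at hg
    exact hng hg

theorem LinearMap.exists_nondegenerate_bilinForm_selfAdjoint {K V : Type*} [Field K]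
    [AddCommGroup V] [Module K V] [FiniteDimensional K V] (f : V →ₗ[K] V) :
    ∃ B : LinearMap.BilinForm K V, B.Nondegenerate ∧ ∀ x y, B (f x) y = B x (f y) := by
  obtain ⟨ι, _, p, hp, e, ⟨φ⟩⟩ := Module.equiv_directSum_of_isTorsion
    (Module.AEval.isTorsion_of_finiteDimensional K V f)
  classical
  choose l hl hl' using fun i =>
    Polynomial.exists_functional_ker_dvd (pow_ne_zero (e i) (hp i).ne_zero)
  let A := Π i, K[X] ⧸ K[X] ∙ p i ^ e i
  let L (i : ι) : (K[X] ⧸ K[X] ∙ p i ^ e i) →ₗ[K] K :=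
    ((K[X] ∙ p i ^ e i).restrictScalars K).liftQ (l i) fun g hg =>
      hl i g (Ideal.mem_span_singleton.1 hg)
  let T : A →ₗ[K] K := ∑ i, L i ∘ₗ LinearMap.proj i
  have hT' (a : A) : T a = ∑ i, L i (a i) := LinearMap.sum_apply ..
  have hT : ∀ a : A, (∀ b, T (a * b) = 0) → a = 0 := by
    intro a ha
    funext i
    obtain ⟨g, hg⟩ := Ideal.Quotient.mk_surjective (a i)
    rw [← hg, Pi.zero_apply, Ideal.Quotient.eq_zero_iff_dvd]
    refine hl' i g fun h => ?_
    have := ha (Pi.single i (Ideal.Quotient.mk _ h))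
    rw [← Pi.single_mul_right, ← hg, ← map_mul] at this
    rw [hT', Finset.sum_eq_single i (fun j _ hj => by rw [Pi.single_eq_of_ne hj, map_zero]) (by simp),
      Pi.single_eq_same] at this
    exact this
  let ψ : V ≃ₗ[K] A := Module.AEval'.of f ≪≫ₗ
    (φ ≪≫ₗ DirectSum.linearEquivFunOnFintype K[X] ι _).restrictScalars K
  have hψ (x : V) : ψ (f x) = (X : K[X]) • ψ x := by
    simp only [ψ, LinearEquiv.trans_apply, ← Module.AEval'.X_smul_of,
      LinearEquiv.restrictScalars_apply, map_smul]
  let B : LinearMap.BilinForm K V :=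
    ((LinearMap.mul K A).compr₂ T).compl₁₂ (ψ : V →ₗ[K] A) (ψ : V →ₗ[K] A)
  have hB (x y : V) : B x y = T (ψ x * ψ y) := rfl
  have hsep (x : V) (hx : ∀ y, B x y = 0) : x = 0 := by
    refine ψ.map_eq_zero_iff.1 (hT _ fun b => ?_)
    simpa [hB] using hx (ψ.symm b)
  refine ⟨B, ⟨hsep, fun x hx => hsep x fun y => ?_⟩, fun x y => ?_⟩
  · rw [← hx y, hB, hB, mul_comm]
  · rw [hB, hB, hψ, hψ, smul_mul_assoc, mul_smul_comm]

theorem Matrix.exists_units_mul_eq_transpose_mul {K n : Type*} [Field K] [Fintype n]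
    [DecidableEq n] (c : Matrix n n K) :
    ∃ P : (Matrix n n K)ˣ, (P : Matrix n n K) * c = c.transpose * P := by
  obtain ⟨B, hB, hc⟩ := LinearMap.exists_nondegenerate_bilinForm_selfAdjoint (Matrix.toLin' c)
  have hdet := (LinearMap.BilinForm.nondegenerate_iff_det_ne_zero (Pi.basisFun K n)).1 hB
  rw [LinearMap.BilinForm.toMatrix_basisFun] at hdet
  refine ⟨Matrix.nonsingInvUnit _ (isUnit_iff_ne_zero.2 hdet), ?_⟩
  have h := LinearMap.BilinForm.ext (B := B.compLeft (Matrix.toLin' c))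
    (D := B.compRight (Matrix.toLin' c)) hc
  apply_fun LinearMap.BilinForm.toMatrix' at h
  rw [LinearMap.BilinForm.toMatrix'_compLeft, LinearMap.BilinForm.toMatrix'_compRight,
    LinearMap.toMatrix'_toLin'] at h
  exact h.symm

theorem Matrix.exists_algEquiv_mulOpposite_apply_self {K n : Type*} [Field K] [Fintype n]
    [DecidableEq n] (c : Matrix n n K) :
    ∃ σ : Matrix n n K ≃ₐ[K] (Matrix n n K)ᵐᵒᵖ, σ c = MulOpposite.op c := by
  obtain ⟨P, hP⟩ := c.exists_units_mul_eq_transpose_mul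
  refine ⟨(MulSemiringAction.toAlgEquiv K _ (ConjAct.toConjAct P)).trans
    (Matrix.transposeAlgEquiv n K K), ?_⟩
  have : (P : Matrix n n K) * c * (P⁻¹ : (Matrix n n K)ˣ) = c.transpose := by
    rw [hP, mul_assoc, P.mul_inv, mul_one]
  change MulOpposite.op ((P : Matrix n n K) * c * (P⁻¹ : (Matrix n n K)ˣ)).transpose = _
  rw [this, Matrix.transpose_transpose]

theorem Subalgebra.nonempty_centralizer_algEquiv_mulOpposite {K A : Type*} [CommRing K] [Ring A]
    [Algebra K A] {c : A} (σ : A ≃ₐ[K] Aᵐᵒᵖ) (hσ : σ c = MulOpposite.op c) :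
    Nonempty (Subalgebra.centralizer K {c} ≃ₐ[K] (Subalgebra.centralizer K {c})ᵐᵒᵖ) := by
  have h (a : A) (ha : a ∈ Subalgebra.centralizer K {c}) :
      (σ a).unop ∈ Subalgebra.centralizer K {c} := by
    simp only [Subalgebra.mem_centralizer_iff, Set.mem_singleton_iff, forall_eq] at ha ⊢
    apply MulOpposite.op_injective
    simp [← hσ, ← map_mul, ha]
  have h' (a : A) (ha : a ∈ Subalgebra.centralizer K {c}) :
      σ.symm (MulOpposite.op a) ∈ Subalgebra.centralizer K {c} := by
    simp only [Subalgebra.mem_centralizer_iff, Set.mem_singleton_iff, forall_eq] at ha ⊢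
    apply σ.injective
    simp [hσ, ← MulOpposite.op_mul, ha]
  refine ⟨AlgEquiv.ofLinearEquiv
    { toFun a := MulOpposite.op ⟨_, h a a.2⟩
      invFun a := ⟨_, h' _ a.unop.2⟩
      map_add' a b := ?_
      map_smul' r a := ?_
      left_inv a := ?_
      right_inv a := ?_ } ?_ fun a b => ?_⟩
  · exact MulOpposite.unop_injective (Subtype.ext (by simp))
  · exact MulOpposite.unop_injective (Subtype.ext (by simp))
  · exact Subtype.ext (by simp)
  · exact MulOpposite.unop_injective (Subtype.ext (by simp))
  · exact MulOpposite.unop_injective (Subtype.ext (by simp))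
  · exact MulOpposite.unop_injective (Subtype.ext (by simp))

/-- The centralizer algebra `S_n(c,R)` is anti-isomorphic to itself:
`S_n(c,R) ≅ S_n(c,R)ᵒᵖ` as `R`-algebras. -/
theorem stmt1 (R : Type*) [Field R] (n : ℕ) (hn : 0 < n) (c : Matrix (Fin n) (Fin n) R) :
    Nonempty ((Subalgebra.centralizer R ({c} : Set (Matrix (Fin n) (Fin n) R))) ≃ₐ[R]
      (Subalgebra.centralizer R ({c} : Set (Matrix (Fin n) (Fin n) R)))ᵐᵒᵖ) := by
  obtain ⟨σ, hσ⟩ := c.exists_algEquiv_mulOpposite_apply_self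
  exact Subalgebra.nonempty_centralizer_algEquiv_mulOpposite σ hσ
end

section
/- Let R be a field and c ∈ M_n(R) with minimal polynomial m_c(x) and characteristic polynomial p_c(x). Then S_n(c,R) = R[c] if and only if m_c(x) = p_c(x). -/
open Polynomial Module in
/-- A finitely generated torsion module over a PID embeds linearly in its endomorphism algebra. -/
theorem exists_injective_linearMap_end_of_isTorsion {A M : Type*} [CommRing A] [IsDomain A]
    [IsPrincipalIdealRing A] [AddCommGroup M] [Module A M] [Module.Finite A M]
    (hM : Module.IsTorsion A M) :
    ∃ φ : M →ₗ[A] Module.End A M, Function.Injective φ := by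
  classical
  obtain ⟨ι, _, p, -, k, ⟨e⟩⟩ := Module.equiv_directSum_of_isTorsion hM
  let e' : M ≃ₗ[A] ((i : ι) → A ⧸ Submodule.span A {p i ^ k i}) :=
    e.trans (DirectSum.linearEquivFunOnFintype A ι _)
  let mulMap : ((i : ι) → A ⧸ Ideal.span {p i ^ k i}) →ₗ[A]
      Module.End A ((i : ι) → A ⧸ Ideal.span {p i ^ k i}) := LinearMap.mul A _
  have hmul : Function.Injective mulMap := fun x y h => by
    simpa [mulMap] using LinearMap.congr_fun h 1
  exact ⟨e'.conj.symm.toLinearMap ∘ₗ mulMap ∘ₗ e'.toLinearMap,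
    e'.conj.symm.injective.comp (hmul.comp e'.injective)⟩

namespace Module.End

open Polynomial

variable {K V : Type*} [Field K] [AddCommGroup V] [Module K V]

theorem mem_centralizer_singleton_iff {f g : Module.End K V} :
    g ∈ Subalgebra.centralizer K {f} ↔ ∀ v, f (g v) = g (f v) := by
  simp only [Subalgebra.mem_centralizer_iff, Set.mem_singleton_iff, forall_eq]
  exact LinearMap.ext_iff

theorem isTorsion_aeval' [FiniteDimensional K V] (f : Module.End K V) :
    Module.IsTorsion K[X] (Module.AEval' f) :=
  Module.AEval.isTorsion_of_finiteDimensional K V f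

theorem finrank_le_finrank_centralizer [FiniteDimensional K V] (f : Module.End K V) :
    Module.finrank K V ≤ Module.finrank K (Subalgebra.centralizer K {f}) := by
  obtain ⟨φ, hφ⟩ := exists_injective_linearMap_end_of_isTorsion (isTorsion_aeval' f)
  let o := Module.AEval'.of f
  let ψ : V →ₗ[K] Module.End K V :=
    { toFun := fun v => o.symm.toLinearMap ∘ₗ (φ (o v)).restrictScalars K ∘ₗ o.toLinearMap
      map_add' := fun v w => by ext; simp
      map_smul' := fun r v => by
        ext w
        change o.symm (φ (o (r • v)) (o w)) = r • o.symm (φ (o v) (o w))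
        rw [map_smul, ← Module.AEval.C_smul, map_smul, LinearMap.smul_apply,
          Module.AEval.C_smul, map_smul] }
  have hψ : ∀ v, ψ v ∈ Subalgebra.centralizer K {f} := fun v =>
    mem_centralizer_singleton_iff.2 fun w => by
      change f (o.symm (φ (o v) (o w))) = o.symm (φ (o v) (o (f w)))
      rw [← Module.AEval'.X_smul_of, map_smul, Module.AEval'.of_symm_X_smul]
  refine LinearMap.finrank_le_finrank_of_injective
    (f := ψ.codRestrict (Subalgebra.toSubmodule (Subalgebra.centralizer K {f})) hψ) ?_
  intro v w h
  refine o.injective (hφ (LinearMap.ext fun x => o.symm.injective ?_))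
  have hvw : ψ v (o.symm x) = ψ w (o.symm x) :=
    LinearMap.congr_fun (congrArg Subtype.val h) (o.symm x)
  simpa [ψ] using hvw

theorem finrank_adjoin_singleton_le [FiniteDimensional K V] (f : Module.End K V) :
    Module.finrank K (Algebra.adjoin K {f}) ≤ (minpoly K f).natDegree := by
  have hf : IsIntegral K f := Algebra.IsIntegral.isIntegral f
  let T : degreeLT K (minpoly K f).natDegree →ₗ[K] Module.End K V :=
    (aeval f).toLinearMap ∘ₗ (degreeLT K _).subtype
  have hT : Subalgebra.toSubmodule (Algebra.adjoin K {f}) ≤ LinearMap.range T := by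
    intro g hg
    rw [Subalgebra.mem_toSubmodule, Algebra.adjoin_singleton_eq_range_aeval] at hg
    obtain ⟨p, rfl⟩ := hg
    refine ⟨⟨p %ₘ minpoly K f, ?_⟩, ?_⟩
    · rw [mem_degreeLT, ← degree_eq_natDegree (minpoly.ne_zero hf)]
      exact degree_modByMonic_lt p (minpoly.monic hf)
    · simp [T, aeval_modByMonic_eq_self_of_root (minpoly.aeval K f)]
  calc Module.finrank K (Algebra.adjoin K {f}) ≤ Module.finrank K (LinearMap.range T) :=
        Submodule.finrank_mono hT
    _ ≤ Module.finrank K (degreeLT K (minpoly K f).natDegree) := LinearMap.finrank_range_le T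
    _ = (minpoly K f).natDegree := by
        rw [(degreeLTEquiv K _).finrank_eq, Module.finrank_fin_fun]

/-- If the minimal polynomial has full degree, then there is a cyclic vector. -/
theorem exists_forall_exists_aeval_apply_eq [FiniteDimensional K V] {f : Module.End K V}
    (h : (minpoly K f).natDegree = Module.finrank K V) :
    ∃ v : V, ∀ w, ∃ p : K[X], aeval f p v = w := by
  obtain ⟨x, hx⟩ := Module.exists_ker_toSpanSingleton_eq_annihilator K[X] (Module.AEval' f)
  obtain ⟨v, rfl⟩ := (Module.AEval'.of f).surjective x
  rw [← span_minpoly_eq_annihilator] at hx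
  have hdvd : ∀ p : K[X], aeval f p v = 0 → minpoly K f ∣ p := fun p hp => by
    rw [← Ideal.mem_span_singleton, ← hx]
    exact hp
  let T : degreeLT K (minpoly K f).natDegree →ₗ[K] V :=
    LinearMap.applyₗ v ∘ₗ (aeval f).toLinearMap ∘ₗ (degreeLT K _).subtype
  have : FiniteDimensional K (degreeLT K (minpoly K f).natDegree) :=
    (degreeLTEquiv K _).symm.finiteDimensional
  have hT : Function.Injective T := by
    refine (injective_iff_map_eq_zero T).2 fun p hp => Subtype.ext ?_
    refine eq_zero_of_dvd_of_degree_lt (hdvd p hp) ?_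
    rw [degree_eq_natDegree (minpoly.ne_zero (Algebra.IsIntegral.isIntegral f))]
    exact mem_degreeLT.1 p.2
  have hsurj := (LinearMap.injective_iff_surjective_of_finrank_eq_finrank (f := T) (by
    rw [(degreeLTEquiv K _).finrank_eq, Module.finrank_fin_fun, h])).1 hT
  exact ⟨v, fun w => (hsurj w).imp' Subtype.val fun _ hp => hp⟩

theorem minpoly_eq_charpoly_iff_natDegree [FiniteDimensional K V] (f : Module.End K V) :
    minpoly K f = f.charpoly ↔ Module.finrank K V ≤ (minpoly K f).natDegree := by
  refine ⟨fun h => by rw [h, LinearMap.charpoly_natDegree], fun h => ?_⟩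
  refine (eq_of_monic_of_dvd_of_natDegree_le (minpoly.monic
    (Algebra.IsIntegral.isIntegral f)) f.charpoly_monic f.minpoly_dvd_charpoly ?_).symm
  rwa [LinearMap.charpoly_natDegree]

theorem centralizer_eq_adjoin_iff_minpoly_eq_charpoly [FiniteDimensional K V]
    (f : Module.End K V) :
    Subalgebra.centralizer K {f} = Algebra.adjoin K {f} ↔ minpoly K f = f.charpoly := by
  constructor
  · intro h
    rw [minpoly_eq_charpoly_iff_natDegree]
    refine (finrank_le_finrank_centralizer f).trans ?_
    rw [h]
    exact finrank_adjoin_singleton_le f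
  · intro h
    obtain ⟨v, hv⟩ := exists_forall_exists_aeval_apply_eq (f := f)
      (by rw [h, LinearMap.charpoly_natDegree])
    refine le_antisymm (fun g hg => ?_) ?_
    · obtain ⟨p, hp⟩ := hv (g v)
      have hgf : Commute f g := (Subalgebra.mem_centralizer_iff K).1 hg f rfl
      rw [Algebra.adjoin_singleton_eq_range_aeval]
      refine ⟨p, LinearMap.ext fun w => ?_⟩
      obtain ⟨q, rfl⟩ := hv w
      have hq : Commute (aeval f q) g := by
        induction q using Polynomial.induction_on' with
        | add a b ha hb => simpa using ha.add_left hb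
        | monomial k a =>
          rw [aeval_monomial]
          exact (Algebra.commute_algebraMap_left a g).mul_left (hgf.pow_left k)
      calc aeval f p (aeval f q v) = aeval f q (aeval f p v) := by
            rw [← Module.End.mul_apply, ← Module.End.mul_apply, ← map_mul, ← map_mul, mul_comm]
        _ = g (aeval f q v) := by rw [hp]; exact LinearMap.congr_fun hq.eq v
    · rw [Algebra.adjoin_le_iff, Set.singleton_subset_iff]
      exact mem_centralizer_singleton_iff.2 fun _ => rfl

end Module.End

/-- `S_n(c,R) = R[c]` if and only if the minimal polynomial of `c` equals its characteristic
polynomial. -/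
theorem stmt3 (R : Type*) [Field R] (n : ℕ) (hn : 0 < n) (c : Matrix (Fin n) (Fin n) R) :
    Subalgebra.centralizer R ({c} : Set (Matrix (Fin n) (Fin n) R)) = Algebra.adjoin R {c} ↔
      minpoly R c = c.charpoly := by
  let e := Matrix.toLinAlgEquiv' (R := R) (n := Fin n)
  have hcent : (Subalgebra.centralizer R {c}).map e.toAlgHom = Subalgebra.centralizer R {e c} := by
    ext g
    obtain ⟨a, rfl⟩ := e.surjective g
    simp [Subalgebra.mem_map, Subalgebra.mem_centralizer_iff, ← map_mul]
  have hadj : (Algebra.adjoin R {c}).map e.toAlgHom = Algebra.adjoin R {e c} := by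
    simp [AlgHom.map_adjoin]
  rw [← (Subalgebra.map_injective (f := e.toAlgHom) e.injective).eq_iff, hcent, hadj,
    Module.End.centralizer_eq_adjoin_iff_minpoly_eq_charpoly, minpoly.algEquiv_eq,
    show e c = Matrix.toLin' c from rfl, Matrix.charpoly_toLin']
end

section
/- Let R be a field of characteristic p > 0 (or p = 0) and let σ ∈ Σ_n be a permutation of cycle type (λ_1, ..., λ_k), with permutation matrix c_σ ∈ M_n(R). Then the set of elementary divisors of c_σ is {f(x)^{p^{ν_p(λ_i)}} : i ∈ [k], f(x) irreducible in R[x], f(x) divides x^{λ_i} − 1}, where ν_p(m) is the p-adic valuation of m (and p^{ν_p(m)} := 1 when p = 0). -/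
/-- `q` is an elementary divisor of the matrix `c` if `q = f^t` is a positive power of an
irreducible polynomial and the `R[x]`-module `R^n` (with `x` acting as `c`) has a direct
summand isomorphic to `R[x]/(q)`. -/
def IsElementaryDivisor {R : Type} [Field R] {n : ℕ} (c : Matrix (Fin n) (Fin n) R)
    (q : Polynomial R) : Prop :=
  (∃ f : Polynomial R, Irreducible f ∧ ∃ t : ℕ, 1 ≤ t ∧ q = f ^ t) ∧
  ∃ W W' : Submodule (Polynomial R) (Module.AEval' (Matrix.mulVecLin c)),
    IsCompl W W' ∧ Nonempty (W ≃ₗ[Polynomial R] (Polynomial R ⧸ Ideal.span {q}))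

open Polynomial

section Module

variable {A M : Type*} [CommRing A] [IsDomain A] [AddCommGroup M] [Module A M]

/-- A complemented cyclic submodule with annihilator `(a * h)`, where `a` and `h` are coprime,
gives a complemented submodule isomorphic to `A ⧸ (a)`. -/
theorem exists_isCompl_quotient_of_isCoprime {d : M} {N : Submodule A M}
    (hN : IsCompl (Submodule.span A {d}) N) {a h : A} (hah : IsCoprime a h) (h0 : h ≠ 0)
    (hd : ∀ r : A, r • d = 0 ↔ a * h ∣ r) :
    ∃ W W' : Submodule A M, IsCompl W W' ∧ Nonempty (W ≃ₗ[A] (A ⧸ Ideal.span {a})) := by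
  have hann : ∀ r : A, r • h • d = 0 ↔ a ∣ r := fun r => by
    rw [smul_smul, hd, mul_dvd_mul_iff_right h0]
  refine ⟨Submodule.span A {h • d}, Submodule.span A {a • d} ⊔ N, ⟨?_, ?_⟩, ?_⟩
  · rw [Submodule.disjoint_def]
    intro x hx hx'
    obtain ⟨r, rfl⟩ := Submodule.mem_span_singleton.1 hx
    obtain ⟨y, hy, z, hz, hyz⟩ := Submodule.mem_sup.1 hx'
    obtain ⟨s, rfl⟩ := Submodule.mem_span_singleton.1 hy
    have hz' : z = (r * h - s * a) • d := by
      rw [sub_smul, mul_smul, mul_smul, ← hyz]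
      abel
    have hz0 : z = 0 := Submodule.disjoint_def.1 hN.disjoint z
      (hz' ▸ Submodule.smul_mem _ _ (Submodule.mem_span_singleton_self d)) hz
    have h1 : a * h ∣ r * h - s * a := (hd _).1 (hz' ▸ hz0)
    have h2 : a ∣ r * h := by
      have := dvd_add ((Dvd.intro _ rfl).trans h1) (Dvd.intro_left s rfl : a ∣ s * a)
      simpa using this
    exact (hann r).2 (hah.dvd_of_dvd_mul_right h2)
  · rw [codisjoint_iff, ← sup_assoc, eq_top_iff, ← hN.sup_eq_top]
    refine sup_le_sup_right ?_ N
    rw [Submodule.span_singleton_le_iff_mem]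
    obtain ⟨u, v, huv⟩ := hah
    have hsum : v • h • d + u • a • d = d := by
      rw [smul_smul, smul_smul, ← add_smul, add_comm, huv, one_smul]
    have hmem := Submodule.add_mem_sup
      (Submodule.smul_mem _ v (Submodule.mem_span_singleton_self (R := A) (h • d)))
      (Submodule.smul_mem _ u (Submodule.mem_span_singleton_self (R := A) (a • d)))
    rwa [hsum] at hmem
  · have hker : LinearMap.ker (LinearMap.toSpanSingleton A M (h • d)) = Ideal.span {a} := by
      ext r
      rw [LinearMap.mem_ker, LinearMap.toSpanSingleton_apply, hann, Ideal.mem_span_singleton]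
    exact ⟨((Submodule.quotEquivOfEq _ _ hker.symm).trans
      ((LinearMap.toSpanSingleton A M (h • d)).quotKerEquivRange.trans
        (LinearEquiv.ofEq _ _ (LinearMap.range_toSpanSingleton _)))).symm⟩

/-- A direct summand isomorphic to `A ⧸ (f ^ (t + 1))` contains an element killed by `f ^ (t + 1)`
whose multiple by `f ^ t` is not divisible by `f ^ (t + 1)` in the whole module. -/
theorem exists_pow_smul_ne_of_isCompl {f : A} (hf : ¬ IsUnit f) (hf0 : f ≠ 0) {t : ℕ}
    {W W' : Submodule A M} (hW : IsCompl W W')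
    (e : W ≃ₗ[A] (A ⧸ Ideal.span {f ^ (t + 1)})) :
    ∃ m : M, f ^ (t + 1) • m = 0 ∧ ∀ y : M, f ^ t • m ≠ f ^ (t + 1) • y := by
  have hkill : ∀ w : W, f ^ (t + 1) • w = 0 := fun w => by
    apply e.injective
    obtain ⟨r, hr⟩ := Ideal.Quotient.mk_surjective (e w)
    rw [map_smul, ← hr, map_zero, ← Ideal.Quotient.mk_eq_mk, ← Submodule.Quotient.mk_smul,
      Submodule.Quotient.mk_eq_zero, Ideal.mem_span_singleton, smul_eq_mul]
    exact Dvd.intro _ rfl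
  refine ⟨(e.symm (Ideal.Quotient.mk _ 1) : W), ?_, fun y hy => ?_⟩
  · rw [← Submodule.coe_smul, hkill, Submodule.coe_zero]
  · have hy' : y ∈ W ⊔ W' := hW.sup_eq_top ▸ Submodule.mem_top
    obtain ⟨u, hu, v, hv, rfl⟩ := Submodule.mem_sup.1 hy'
    have hu0 : f ^ (t + 1) • u = 0 := congrArg Subtype.val (hkill ⟨u, hu⟩)
    rw [smul_add, hu0, zero_add] at hy
    have h0 := Submodule.disjoint_def.1 hW.disjoint _
      (Submodule.smul_mem W (f ^ t) (e.symm (Ideal.Quotient.mk _ 1)).2)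
      (hy ▸ Submodule.smul_mem W' _ hv)
    rw [← Submodule.coe_smul, Submodule.coe_eq_zero, ← map_smul, LinearEquiv.map_eq_zero_iff,
      ← Ideal.Quotient.mk_eq_mk, ← Submodule.Quotient.mk_smul,
      Submodule.Quotient.mk_eq_zero, Ideal.mem_span_singleton, smul_eq_mul, mul_one,
      pow_dvd_pow_iff hf0 hf] at h0
    omega

theorem eq_of_pow_smul_ne [IsPrincipalIdealRing A] {f h : A} (hf : Irreducible f) {s t : ℕ}
    (hfh : ¬ f ∣ h) {d : M} (hd : ∀ r : A, r • d = 0 ↔ f ^ s * h ∣ r) {r : A}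
    (h0 : f ^ (t + 1) • r • d = 0) (hne : ∀ y : M, f ^ t • r • d ≠ f ^ (t + 1) • y) :
    s = t + 1 := by
  rcases lt_trichotomy s (t + 1) with hlt | heq | hgt
  · exfalso
    obtain ⟨a, b, hab⟩ := (hf.coprime_iff_not_dvd).2 hfh
    apply hne (a • r • d)
    have h1 : (b * r * (h * f ^ t)) • d = 0 := by
      rw [hd, mul_comm h]
      exact Dvd.dvd.mul_left (mul_dvd_mul_right (pow_dvd_pow f (by omega)) h) _
    rw [smul_smul, smul_smul, smul_smul, ← sub_eq_zero, ← sub_smul, ← h1]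
    congr 1
    linear_combination (-(f ^ t * r)) * hab
  · exact heq
  · exfalso
    rw [smul_smul, hd] at h0
    obtain ⟨k, rfl⟩ : ∃ k, s = t + 1 + (k + 1) := ⟨s - (t + 1) - 1, by omega⟩
    rw [pow_add f (t + 1), mul_assoc, mul_dvd_mul_iff_left (pow_ne_zero _ hf.ne_zero)] at h0
    obtain ⟨c, rfl⟩ : f ∣ r := ((dvd_pow_self f (Nat.succ_ne_zero k)).mul_right h).trans h0
    apply hne (c • d)
    rw [smul_smul, smul_smul]
    congr 1
    ring

end Module

theorem exists_X_pow_sub_one_eq_pow_mul {R : Type*} [Field R] (p : ℕ) [CharP R p] {l : ℕ}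
    (hl : l ≠ 0) {f : R[X]} (hf : Irreducible f) (hdvd : f ∣ X ^ l - 1) :
    ∃ h : R[X], X ^ l - 1 = f ^ p ^ l.factorization p * h ∧ ¬ f ∣ h := by
  obtain ⟨m, hm, hl'⟩ : ∃ m : ℕ, (m : R) ≠ 0 ∧
      (X ^ l - 1 : R[X]) = (X ^ m - 1) ^ p ^ l.factorization p := by
    rcases CharP.char_is_prime_or_zero R p with hp | rfl
    · have := Fact.mk hp
      refine ⟨l / p ^ l.factorization p, ?_, ?_⟩
      · rw [Ne, CharP.cast_eq_zero_iff R p]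
        exact Nat.not_dvd_ordCompl hp hl
      · rw [sub_pow_char_pow, ← pow_mul, one_pow, mul_comm, Nat.ordProj_mul_ordCompl_eq_self]
    · have := CharP.charP_to_charZero R
      exact ⟨l, by exact_mod_cast hl, by simp⟩
  rw [hl'] at hdvd ⊢
  obtain ⟨k, hk⟩ := hf.prime.dvd_of_dvd_pow hdvd
  refine ⟨k ^ p ^ l.factorization p, by rw [hk, mul_pow], fun hfk => ?_⟩
  have hsq := (X_pow_sub_one_separable_iff.2 hm).squarefree
  rw [hk] at hsq
  exact hf.not_isUnit (hsq f (mul_dvd_mul_left f (hf.prime.dvd_of_dvd_pow hfk)))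

namespace Equiv.Perm

variable (R : Type) [Field R] {n : ℕ} (σ : Equiv.Perm (Fin n))

/-- The `R[X]`-module `R ^ n` on which `X` acts as the permutation matrix of `σ`. -/
abbrev PolynomialModule : Type := Module.AEval' (Matrix.mulVecLin (σ.permMatrix R))

/-- The standard basis vector at `i`, as an element of `PolynomialModule`. -/
noncomputable def delta (i : Fin n) : σ.PolynomialModule R :=
  Module.AEval'.of (Matrix.mulVecLin (σ.permMatrix R)) (Pi.single i 1)

variable {R} in
theorem X_smul_of (v : Fin n → R) :
    (X : R[X]) • Module.AEval'.of (Matrix.mulVecLin (σ.permMatrix R)) v =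
      Module.AEval'.of (Matrix.mulVecLin (σ.permMatrix R)) (v ∘ σ) := by
  rw [Module.AEval'.X_smul_of, Matrix.mulVecLin_apply, Matrix.permMatrix_mulVec]

theorem X_pow_smul_delta (i : Fin n) (k : ℕ) :
    (X ^ k : R[X]) • σ.delta R ((σ ^ k) i) = σ.delta R i := by
  induction k with
  | zero => simp
  | succ k ih =>
    rw [pow_succ X, mul_smul, pow_succ' σ, mul_apply, delta, X_smul_of, ← ih, delta]
    congr 2
    ext j
    simp [Pi.single_apply]

theorem coeff_smul_delta (i : Fin n) {r : R[X]}
    (hr : r.natDegree < Function.minimalPeriod σ i)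
    {a : ℕ} (ha : a < Function.minimalPeriod σ i) :
    (Module.AEval'.of (Matrix.mulVecLin (σ.permMatrix R))).symm (r • σ.delta R i)
      ((σ ^ a)⁻¹ i) = r.coeff a := by
  have hterm : ∀ k, (X ^ k : R[X]) • σ.delta R i = σ.delta R ((σ ^ k)⁻¹ i) := fun k => by
    rw [← σ.X_pow_smul_delta R ((σ ^ k)⁻¹ i) k, ← mul_apply, mul_inv_cancel, one_apply]
  conv_lhs => rw [r.as_sum_range' _ hr]
  rw [Finset.sum_smul, map_sum, Finset.sum_apply, Finset.sum_eq_single a]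
  · rw [← C_mul_X_pow_eq_monomial, mul_smul, hterm, Module.AEval.C_smul, map_smul, delta,
      LinearEquiv.symm_apply_apply, Pi.smul_apply, Pi.single_eq_same, smul_eq_mul, mul_one]
  · intro k hk hka
    have hne : (σ ^ a)⁻¹ i ≠ (σ ^ k)⁻¹ i := fun h => by
      have h' : (σ ^ k) i = (σ ^ a) i := by
        calc (σ ^ k) i = (σ ^ k * σ ^ a) ((σ ^ a)⁻¹ i) := by
              rw [← mul_apply, mul_assoc, mul_inv_cancel, mul_one]
          _ = (σ ^ a * σ ^ k) ((σ ^ k)⁻¹ i) := by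
              rw [h, ← pow_add, ← pow_add, add_comm]
          _ = (σ ^ a) i := by rw [← mul_apply, mul_assoc, mul_inv_cancel, mul_one]
      rw [← iterate_eq_pow, ← iterate_eq_pow] at h'
      exact hka ((Function.iterate_eq_iterate_iff_of_lt_minimalPeriod
        (Finset.mem_range.1 hk) ha).1 h')
    rw [← C_mul_X_pow_eq_monomial, mul_smul, hterm, Module.AEval.C_smul, map_smul, delta,
      LinearEquiv.symm_apply_apply, Pi.smul_apply, Pi.single_eq_of_ne hne, smul_zero]
  · intro h
    exact absurd (Finset.mem_range.2 ha) h

theorem smul_delta_eq_zero_iff (i : Fin n) (r : R[X]) :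
    r • σ.delta R i = 0 ↔ X ^ Function.minimalPeriod σ i - 1 ∣ r := by
  set l := Function.minimalPeriod σ i with hl
  have hlpos : 0 < l := Function.minimalPeriod_pos_of_mem_periodicPts
    (σ.injective.mem_periodicPts i)
  have hker : (X ^ l - 1 : R[X]) • σ.delta R i = 0 := by
    have h := σ.X_pow_smul_delta R i l
    have hi : (σ ^ l) i = i := by
      rw [← iterate_eq_pow]
      exact Function.iterate_minimalPeriod
    rw [hi] at h
    rw [sub_smul, h, one_smul, sub_self]
  have hmonic : (X ^ l - 1 : R[X]).Monic := monic_X_pow_sub_C 1 hlpos.ne'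
  refine ⟨fun h => ?_, ?_⟩
  · rw [← modByMonic_eq_zero_iff_dvd hmonic]
    have hmod : (r %ₘ (X ^ l - 1)) • σ.delta R i = 0 := by
      rw [← h]
      conv_rhs => rw [← modByMonic_add_div r (X ^ l - 1), add_smul, mul_comm, mul_smul, hker,
        smul_zero, add_zero]
    have hdeg : (r %ₘ (X ^ l - 1)).natDegree < l := by
      have := natDegree_modByMonic_lt r hmonic (by
        intro h1
        have := congrArg natDegree h1
        rw [← C_1, natDegree_X_pow_sub_C, natDegree_C] at this
        omega)
      rwa [← C_1, natDegree_X_pow_sub_C, C_1] at this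
    ext a
    rcases lt_or_ge a l with ha | ha
    · rw [← σ.coeff_smul_delta R i hdeg ha, hmod, map_zero, Pi.zero_apply, coeff_zero]
    · rw [coeff_eq_zero_of_natDegree_lt (hdeg.trans_le ha), coeff_zero]
  · rintro ⟨c, rfl⟩
    rw [mul_comm, mul_smul, hker, smul_zero]

open Classical in
/-- The projection of `PolynomialModule` onto the vectors supported on the cycle `o`. -/
noncomputable def cycleProj (o : Quotient (SameCycle.setoid σ)) :
    σ.PolynomialModule R →ₗ[R[X]] σ.PolynomialModule R :=
  LinearMap.ofAEval _
    ((Module.AEval'.of (Matrix.mulVecLin (σ.permMatrix R))).toLinearMap ∘ₗ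
      LinearMap.pi fun j => if Quotient.mk _ j = o then LinearMap.proj j else 0) <| by
    intro v
    have hσ : ∀ j, (Quotient.mk (SameCycle.setoid σ) (σ j)) = Quotient.mk _ j := fun j =>
      Quotient.sound (sameCycle_apply_left.2 (SameCycle.refl σ j))
    rw [LinearMap.comp_apply, LinearMap.comp_apply, LinearEquiv.coe_coe, X_smul_of]
    congr 1
    ext j
    simp only [Module.End.smul_def, Matrix.mulVecLin_apply, Matrix.permMatrix_mulVec,
      LinearMap.pi_apply, Function.comp_apply, hσ]
    split_ifs <;> rfl

open Classical in
theorem cycleProj_delta (o : Quotient (SameCycle.setoid σ)) (i : Fin n) :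
    σ.cycleProj R o (σ.delta R i) = if Quotient.mk _ i = o then σ.delta R i else 0 := by
  have : σ.cycleProj R o (σ.delta R i) =
      Module.AEval'.of (Matrix.mulVecLin (σ.permMatrix R)) (fun j =>
        if Quotient.mk _ j = o then (Pi.single i 1 : Fin n → R) j else 0) := by
    refine congrArg (Module.AEval'.of (Matrix.mulVecLin (σ.permMatrix R))) (funext fun j => ?_)
    change (if Quotient.mk _ j = o then LinearMap.proj j else 0 : (Fin n → R) →ₗ[R] R)
      (Pi.single i 1) = _
    split_ifs <;> rfl
  rw [this]
  split_ifs with h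
  · rw [delta]
    congr 1
    ext j
    by_cases hj : j = i
    · subst hj; simp [h]
    · simp [hj]
  · rw [← map_zero (Module.AEval'.of (Matrix.mulVecLin (σ.permMatrix R)))]
    congr 1
    ext j
    by_cases hj : j = i
    · subst hj; simp [h]
    · simp [hj]

theorem span_delta : Submodule.span R[X] (Set.range (σ.delta R)) = ⊤ := by
  rw [eq_top_iff]
  intro m _
  obtain ⟨v, rfl⟩ := (Module.AEval'.of (Matrix.mulVecLin (σ.permMatrix R))).surjective m
  rw [pi_eq_sum_univ' v, map_sum]
  refine Submodule.sum_mem _ fun i _ => ?_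
  rw [map_smul, ← Module.AEval.C_smul]
  refine Submodule.smul_mem _ _ (Submodule.subset_span ⟨i, ?_⟩)
  rw [delta]

theorem cycleProj_mem_span (i : Fin n) (m : σ.PolynomialModule R) :
    σ.cycleProj R (Quotient.mk _ i) m ∈ Submodule.span R[X] {σ.delta R i} := by
  have hm : m ∈ Submodule.span R[X] (Set.range (σ.delta R)) := σ.span_delta R ▸ Submodule.mem_top
  induction hm using Submodule.span_induction with
  | mem x hx =>
    obtain ⟨j, rfl⟩ := hx
    rw [cycleProj_delta]
    split_ifs with h
    · obtain ⟨k, -, rfl⟩ := SameCycle.exists_pow_eq' (f := σ) (Quotient.exact h)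
      rw [← σ.X_pow_smul_delta R j k]
      exact Submodule.smul_mem _ _ (Submodule.mem_span_singleton_self _)
    · exact Submodule.zero_mem _
  | zero => rw [map_zero]; exact Submodule.zero_mem _
  | add x y _ _ hx hy => rw [map_add]; exact Submodule.add_mem _ hx hy
  | smul r x _ hx => rw [map_smul]; exact Submodule.smul_mem _ _ hx

theorem sum_cycleProj [Fintype (Quotient (SameCycle.setoid σ))] (m : σ.PolynomialModule R) :
    ∑ o, σ.cycleProj R o m = m := by
  have hm : m ∈ Submodule.span R[X] (Set.range (σ.delta R)) := σ.span_delta R ▸ Submodule.mem_top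
  induction hm using Submodule.span_induction with
  | mem x hx =>
    obtain ⟨j, rfl⟩ := hx
    simp [cycleProj_delta]
  | zero => simp
  | add x y _ _ hx hy => simp only [map_add, Finset.sum_add_distrib, hx, hy]
  | smul r x _ hx => simp only [map_smul, ← Finset.smul_sum, hx]

theorem isCompl_span_delta (i : Fin n) :
    IsCompl (Submodule.span R[X] {σ.delta R i})
      (LinearMap.ker (σ.cycleProj R (Quotient.mk _ i))) := by
  have hfix : σ.cycleProj R (Quotient.mk _ i) (σ.delta R i) = σ.delta R i := by
    rw [cycleProj_delta, if_pos rfl]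
  refine LinearMap.IsProj.isCompl ⟨σ.cycleProj_mem_span R i, fun x hx => ?_⟩
  obtain ⟨r, rfl⟩ := Submodule.mem_span_singleton.1 hx
  rw [map_smul, hfix]

end Equiv.Perm

/-- For a field `R` of characteristic `p ≥ 0` and a permutation `σ` with cycle lengths
`λ_i` (the orbit sizes), the elementary divisors of the permutation matrix `c_σ` are
exactly the polynomials `f^{p^{ν_p(λ_i)}}` with `f` irreducible dividing `x^{λ_i} - 1`. -/
theorem stmt9 (R : Type) [Field R] (p : ℕ) [CharP R p] (n : ℕ) (σ : Equiv.Perm (Fin n))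
    (q : Polynomial R) :
    IsElementaryDivisor (σ.permMatrix R) q ↔
      ∃ i : Fin n, ∃ f : Polynomial R, Irreducible f ∧
        f ∣ Polynomial.X ^ (Function.minimalPeriod (⇑σ) i) - 1 ∧
        q = f ^ (p ^ ((Function.minimalPeriod (⇑σ) i).factorization p)) := by
  have hper : ∀ i, Function.minimalPeriod σ i ≠ 0 := fun i =>
    (Function.minimalPeriod_pos_of_mem_periodicPts (σ.injective.mem_periodicPts i)).ne'
  have hpow : ∀ l : ℕ, p ^ l.factorization p ≠ 0 := fun l => by
    rcases CharP.char_is_prime_or_zero R p with hp | rfl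
    · exact pow_ne_zero _ hp.ne_zero
    · simp
  constructor
  · rintro ⟨⟨f, hf, t, ht, rfl⟩, W, W', hW, ⟨e⟩⟩
    obtain ⟨t, rfl⟩ : ∃ s, t = s + 1 := ⟨t - 1, by omega⟩
    obtain ⟨m, hm, hne⟩ := exists_pow_smul_ne_of_isCompl hf.not_isUnit hf.ne_zero hW e
    classical
    have : Fintype (Quotient (Equiv.Perm.SameCycle.setoid σ)) := Fintype.ofFinite _
    obtain ⟨o, ho⟩ : ∃ o, ∀ y, f ^ t • σ.cycleProj R o m ≠ f ^ (t + 1) • y := by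
      by_contra! hcon
      choose y hy using hcon
      apply hne (∑ o, y o)
      rw [Finset.smul_sum, ← Finset.sum_congr rfl fun o _ => hy o, ← Finset.smul_sum,
        σ.sum_cycleProj R m]
    obtain ⟨i, rfl⟩ := Quotient.exists_rep o
    obtain ⟨r, hr⟩ := Submodule.mem_span_singleton.1 (σ.cycleProj_mem_span R i m)
    have h0 : f ^ (t + 1) • σ.cycleProj R (Quotient.mk _ i) m = 0 := by
      rw [← map_smul, hm, map_zero]
    rw [← hr] at h0 ho
    have hfdvd : f ∣ X ^ Function.minimalPeriod σ i - 1 := by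
      by_contra hnd
      have := eq_of_pow_smul_ne (s := 0) hf hnd
        (fun r => by rw [pow_zero, one_mul]; exact σ.smul_delta_eq_zero_iff R i r) h0 ho
      omega
    obtain ⟨h, hh, hfh⟩ := exists_X_pow_sub_one_eq_pow_mul p (hper i) hf hfdvd
    refine ⟨i, f, hf, hfdvd, ?_⟩
    have hst := eq_of_pow_smul_ne hf hfh
      (fun r => by rw [← hh]; exact σ.smul_delta_eq_zero_iff R i r) h0 ho
    rw [hst]
  · rintro ⟨i, f, hf, hfdvd, rfl⟩
    refine ⟨⟨f, hf, _, Nat.one_le_iff_ne_zero.2 (hpow _), rfl⟩, ?_⟩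
    obtain ⟨h, hh, hfh⟩ := exists_X_pow_sub_one_eq_pow_mul p (hper i) hf hfdvd
    refine exists_isCompl_quotient_of_isCoprime (σ.isCompl_span_delta R i)
      (hf.coprime_pow_of_not_dvd _ hfh).symm (fun h0 => hfh (h0 ▸ dvd_zero f)) fun r => ?_
    rw [← hh]
    exact σ.smul_delta_eq_zero_iff R i r
end

section
/- Let A and B be finite-dimensional commutative self-injective algebras over a field R, M a faithful finitely generated A-module and N a faithful finitely generated B-module. Then A is isomorphic to the center of End_A(M) and B is isomorphic to the center of End_B(N). -/
/-- A faithful finitely generated module over a commutative self-injective ring is a generator: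
its trace ideal contains `1`. -/
theorem exists_sum_dual_apply_eq_one (A M : Type*) [CommRing A]
    [Module.Injective A A] [AddCommGroup M] [Module A M] [Module.Finite A M] [FaithfulSMul A M] :
    ∃ (n : ℕ) (m : Fin n → M) (φ : Fin n → M →ₗ[A] A), ∑ i, φ i (m i) = 1 := by
  obtain ⟨n, m, hm⟩ := Module.Finite.exists_fin (R := A) (M := M)
  have hinj : Function.Injective (LinearMap.toSpanSingleton A (Fin n → M) m) := by
    intro a b hab
    refine eq_of_smul_eq_smul (α := M) fun x => ?_
    have hx : x ∈ Submodule.span A (Set.range m) := hm ▸ Submodule.mem_top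
    have h : Set.EqOn (LinearMap.lsmul A M a) (LinearMap.lsmul A M b) (Set.range m) := by
      rintro _ ⟨i, rfl⟩
      exact congrFun hab i
    exact LinearMap.eqOn_span h hx
  obtain ⟨g, hg⟩ := Module.Injective.extension_property A A _ _ _ hinj LinearMap.id
  refine ⟨n, m, fun i => g ∘ₗ LinearMap.single A (fun _ => M) i, ?_⟩
  have h1 : g m = 1 := by simpa using LinearMap.congr_fun hg 1
  simp only [LinearMap.comp_apply, ← map_sum, LinearMap.coe_single, Finset.univ_sum_single, h1]

/-- If the trace ideal of `M` contains `1`, then every central endomorphism of `M` is a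
homothety. -/
theorem exists_forall_apply_eq_smul_of_mem_center {A M : Type*} [CommRing A] [AddCommGroup M]
    [Module A M] {n : ℕ} (m : Fin n → M) (φ : Fin n → M →ₗ[A] A) (h : ∑ i, φ i (m i) = 1)
    {f : Module.End A M} (hf : f ∈ Set.center (Module.End A M)) : ∃ a : A, ∀ x, f x = a • x := by
  refine ⟨∑ i, φ i (f (m i)), fun x => ?_⟩
  have hcomm (i : Fin n) : f (φ i (m i) • x) = φ i (f (m i)) • x :=
    (LinearMap.congr_fun (Semigroup.mem_center_iff.mp hf ((φ i).smulRight x)) (m i)).symm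
  calc f x = f ((∑ i, φ i (m i)) • x) := by rw [h, one_smul]
    _ = _ := by simp only [Finset.sum_smul, map_sum, hcomm]

/-- A commutative self-injective algebra is the center of the endomorphism algebra of any faithful
finitely generated module. -/
theorem nonempty_algEquiv_center_end (R A M : Type*) [CommRing R] [CommRing A] [Algebra R A]
    [Module.Injective A A] [AddCommGroup M] [Module A M] [Module R M]
    [IsScalarTower R A M] [SMulCommClass A R M] [Module.Finite A M] [FaithfulSMul A M] :
    Nonempty (A ≃ₐ[R] Subalgebra.center R (Module.End A M)) := by
  have hmem (a : A) : Algebra.lsmul R A M a ∈ Subalgebra.center R (Module.End A M) :=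
    Subalgebra.mem_center_iff.mpr fun f => LinearMap.ext fun x => map_smul f a x
  refine ⟨AlgEquiv.ofBijective ((Algebra.lsmul R A M).codRestrict _ hmem) ⟨?_, ?_⟩⟩
  · intro a b hab
    exact eq_of_smul_eq_smul (α := M) fun x => LinearMap.congr_fun (congrArg Subtype.val hab) x
  · rintro ⟨f, hf⟩
    obtain ⟨n, m, φ, h⟩ := exists_sum_dual_apply_eq_one A M
    obtain ⟨a, ha⟩ := exists_forall_apply_eq_smul_of_mem_center m φ h hf
    exact ⟨a, Subtype.ext (LinearMap.ext fun x => (ha x).symm)⟩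

/-- For finite-dimensional commutative self-injective algebras `A`, `B` over a field `R`
and faithful finitely generated modules `M` over `A` and `N` over `B`, the algebra `A` is
isomorphic to the center of `End_A(M)` and `B` is isomorphic to the center of `End_B(N)`. -/
theorem stmt16 (R A B M N : Type) [Field R]
    [CommRing A] [Algebra R A] [FiniteDimensional R A] [Module.Injective A A]
    [CommRing B] [Algebra R B] [FiniteDimensional R B] [Module.Injective B B]
    [AddCommGroup M] [Module A M] [Module R M] [IsScalarTower R A M]
    [SMulCommClass A R M] [Module.Finite A M] [FaithfulSMul A M]
    [AddCommGroup N] [Module B N] [Module R N] [IsScalarTower R B N]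
    [SMulCommClass B R N] [Module.Finite B N] [FaithfulSMul B N] :
    Nonempty (A ≃ₐ[R] Subalgebra.center R (Module.End A M)) ∧
    Nonempty (B ≃ₐ[R] Subalgebra.center R (Module.End B N)) := by
  exact ⟨nonempty_algEquiv_center_end R A M, nonempty_algEquiv_center_end R B N⟩
end
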